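/- (Uniqueness of Markovian parents under strict positivity.) Let Ω = Ω_1 × ⋯ × Ω_n be a product of nonempty finite sets and P a strictly positive probability measure on Ω. Fix j ∈ {1,…,n}. If K and K′ are both minimal subsets of {1,…,j−1} satisfying (X_j ⊥ {X_i : i ∈ {1,…,j−1} \ K} | {X_i : i ∈ K}) (minimal meaning no proper subset satisfies the corresponding statement), then K = K′. -/

import Mathlib

/-- The marginal probability, under a finitely supported distribution `P` on the
product `Ω = Ω_1 × ⋯ × Ω_n`, of the event that all coordinates in `J` take the
values prescribed by `x`. -/
def marg {n : ℕ} {Ω : Fin n → Type*} [∀ i, Fintype (Ω i)] [∀ i, DecidableEq (Ω i)]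
    (P : (∀ i, Ω i) → ℝ) (J : Finset (Fin n)) (x : ∀ i, Ω i) : ℝ :=
  ∑ y : ∀ i, Ω i, if ∀ i ∈ J, y i = x i then P y else 0

/-- Conditional independence `(X_A ⊥ X_B | X_C)` of the coordinate variables in `A`
from those in `B` given those in `C`, in cross-multiplied form
`P(a,b,c)·P(c) = P(a,c)·P(b,c)` for all value assignments (for strictly positive `P`
this is equivalent to `P(a,b|c) = P(a|c)·P(b|c)` whenever `P(c) > 0`). -/
def CondIndep {n : ℕ} {Ω : Fin n → Type*} [∀ i, Fintype (Ω i)] [∀ i, DecidableEq (Ω i)]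
    (P : (∀ i, Ω i) → ℝ) (A B C : Finset (Fin n)) : Prop :=
  ∀ x : ∀ i, Ω i,
    marg P (A ∪ B ∪ C) x * marg P C x = marg P (A ∪ C) x * marg P (B ∪ C) x

/-- `K` renders `X_j` conditionally independent of all its other predecessors. -/
def Screens {n : ℕ} {Ω : Fin n → Type*} [∀ i, Fintype (Ω i)] [∀ i, DecidableEq (Ω i)]
    (P : (∀ i, Ω i) → ℝ) (j : Fin n) (K : Finset (Fin n)) : Prop :=
  CondIndep P {j} (Finset.Iio j \ K) K

section

variable {n : ℕ} {Ω : Fin n → Type*} [∀ i, Fintype (Ω i)] [∀ i, DecidableEq (Ω i)]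
  {P : (∀ i, Ω i) → ℝ}

theorem marg_pos (hP : ∀ x, 0 < P x) (J : Finset (Fin n)) (x : ∀ i, Ω i) :
    0 < marg P J x := by
  unfold marg
  refine Finset.sum_pos' (fun y _ => ?_) ⟨x, Finset.mem_univ _, ?_⟩
  · split_ifs
    exacts [(hP y).le, le_rfl]
  · simpa using hP x

theorem marg_congr {J : Finset (Fin n)} {x y : ∀ i, Ω i} (h : ∀ i ∈ J, x i = y i) :
    marg P J x = marg P J y := by
  unfold marg
  refine Finset.sum_congr rfl fun z _ => ?_
  have : (∀ i ∈ J, z i = x i) ↔ ∀ i ∈ J, z i = y i :=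
    forall₂_congr fun i hi => by rw [h i hi]
  simp only [this]

/-- Screening means that the conditional probability of `X_j` given all its predecessors
is the one given `K` alone. -/
theorem screens_iff {j : Fin n} {K : Finset (Fin n)} (hK : K ⊆ Finset.Iio j) :
    Screens P j K ↔ ∀ x, marg P (insert j (Finset.Iio j)) x * marg P K x =
      marg P (insert j K) x * marg P (Finset.Iio j) x := by
  simp only [Screens, CondIndep, Finset.union_assoc, Finset.sdiff_union_of_subset hK,
    Finset.insert_eq]

/-- The law of total probability for `X_j`: if the conditional probability of `X_j = x j`
given the coordinates in `I` is a constant `c` on the event `X_S = x_S`, then `c` is also the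
conditional probability given the coordinates in `S`. -/
theorem marg_insert_of_forall_eq_mul (hP : ∀ x, 0 < P x) {j : Fin n} {S I : Finset (Fin n)}
    (hSI : S ⊆ I) (hj : j ∉ I) (x : ∀ i, Ω i) (c : ℝ)
    (hc : ∀ u : ∀ i, Ω i, (∀ i ∈ insert j S, u i = x i) →
      marg P (insert j I) u = c * marg P I u) :
    marg P (insert j S) x = c * marg P S x := by
  have expand (z : ∀ i, Ω i) :
      (if ∀ i ∈ insert j S, z i = x i then P z else 0) =
        ∑ y, if (∀ i ∈ I, y i = z i) ∧ ∀ i ∈ insert j S, z i = x i then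
          P z * P y / marg P I z else 0 := by
    by_cases h : ∀ i ∈ insert j S, z i = x i
    · rw [if_pos h]
      simp only [and_iff_left h]
      rw [← Finset.sum_filter, ← Finset.sum_div, ← Finset.mul_sum, Finset.sum_filter]
      exact (mul_div_cancel_right₀ _ (marg_pos hP I z).ne').symm
    · rw [if_neg h]
      exact (Finset.sum_eq_zero fun y _ => if_neg fun H => h H.2).symm
  have collapse (y : ∀ i, Ω i) :
      (∑ z, if (∀ i ∈ I, y i = z i) ∧ ∀ i ∈ insert j S, z i = x i then
          P z * P y / marg P I z else 0) =
        c * if ∀ i ∈ S, y i = x i then P y else 0 := by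
    by_cases h : ∀ i ∈ S, y i = x i
    · have hu : marg P (insert j I) (Function.update y j (x j)) = c * marg P I y := by
        rw [hc, marg_congr (J := I) (y := y)]
        · intro i hi
          exact Function.update_of_ne (ne_of_mem_of_not_mem hi hj) _ _
        · intro i hi
          by_cases e : i = j
          · subst e; simp
          · rw [Function.update_of_ne e]
            exact h i (Finset.mem_of_mem_insert_of_ne hi e)
      have hy := (marg_pos hP I y).ne'
      rw [if_pos h]
      calc _ = ∑ z, (if ∀ i ∈ insert j I, z i = Function.update y j (x j) i then P z else 0) *
            (P y / marg P I y) := by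
              refine Finset.sum_congr rfl fun z _ => ?_
              have hiff : ((∀ i ∈ I, y i = z i) ∧ ∀ i ∈ insert j S, z i = x i) ↔
                  ∀ i ∈ insert j I, z i = Function.update y j (x j) i := by
                simp only [Finset.forall_mem_insert, Function.update_self]
                have : (∀ i ∈ I, z i = Function.update y j (x j) i) ↔ ∀ i ∈ I, y i = z i :=
                  forall₂_congr fun i hi => by
                    rw [Function.update_of_ne (ne_of_mem_of_not_mem hi hj), eq_comm]
                rw [this]
                exact ⟨fun H => ⟨H.2.1, H.1⟩,
                  fun H => ⟨H.2, H.1, fun i hi => (H.2 i (hSI hi)).symm.trans (h i hi)⟩⟩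
              by_cases hz : (∀ i ∈ I, y i = z i) ∧ ∀ i ∈ insert j S, z i = x i
              · rw [if_pos hz, if_pos (hiff.1 hz), marg_congr hz.1, mul_div_assoc]
              · rw [if_neg hz, if_neg (mt hiff.2 hz), zero_mul]
        _ = marg P (insert j I) (Function.update y j (x j)) * (P y / marg P I y) := by
              rw [← Finset.sum_mul, marg.eq_def P (insert j I)]
        _ = c * P y := by rw [hu]; field_simp
    · rw [if_neg h, mul_zero]
      refine Finset.sum_eq_zero fun z _ => if_neg fun H => h fun i hi => ?_
      rw [H.1 i (hSI hi), H.2 i (Finset.mem_insert_of_mem hi)]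
  rw [marg, Finset.sum_congr rfl fun z _ => expand z, Finset.sum_comm,
    Finset.sum_congr rfl fun y _ => collapse y, ← Finset.mul_sum, marg]

/-- The intersection property of screening sets for a strictly positive distribution. -/
theorem Screens.inter (hP : ∀ x, 0 < P x) {j : Fin n} {K K' : Finset (Fin n)}
    (hKI : K ⊆ Finset.Iio j) (hKI' : K' ⊆ Finset.Iio j)
    (hK : Screens P j K) (hK' : Screens P j K') : Screens P j (K ∩ K') := by
  have hSI : K ∩ K' ⊆ Finset.Iio j := Finset.inter_subset_left.trans hKI
  have ratio {L : Finset (Fin n)} (hL : L ⊆ Finset.Iio j) (h : Screens P j L) (x : ∀ i, Ω i) :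
      marg P (insert j (Finset.Iio j)) x / marg P (Finset.Iio j) x =
        marg P (insert j L) x / marg P L x := by
    rw [div_eq_div_iff (marg_pos hP _ x).ne' (marg_pos hP _ x).ne']
    exact (screens_iff hL).1 h x
  have ratio_congr {L : Finset (Fin n)} (hL : L ⊆ Finset.Iio j) (h : Screens P j L)
      {x y : ∀ i, Ω i} (hxy : ∀ i ∈ insert j L, x i = y i) :
      marg P (insert j (Finset.Iio j)) x / marg P (Finset.Iio j) x =
        marg P (insert j (Finset.Iio j)) y / marg P (Finset.Iio j) y := by
    rw [ratio hL h, ratio hL h, marg_congr hxy,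
      marg_congr fun i hi => hxy i (Finset.mem_insert_of_mem hi)]
  rw [screens_iff hSI]
  intro x
  have hx := (marg_pos hP (Finset.Iio j) x).ne'
  rw [marg_insert_of_forall_eq_mul hP hSI (by simp) x
    (marg P (insert j (Finset.Iio j)) x / marg P (Finset.Iio j) x)]
  · field_simp
  · intro u hu
    rw [← div_eq_iff (marg_pos hP _ u).ne']
    let y : ∀ i, Ω i := fun i => if i ∈ insert j K then u i else x i
    refine (ratio_congr hKI hK (y := y) fun i hi => (if_pos hi).symm).trans
      (ratio_congr hKI' hK' fun i hi => ?_)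
    by_cases h : i ∈ insert j K
    · simp only [y, if_pos h]
      refine hu i ?_
      rw [Finset.insert_inter_distrib]
      exact Finset.mem_inter.2 ⟨h, hi⟩
    · exact if_neg h

end

/-- **uniqueness of Markovian parents under strict positivity.**
If `K` and `K'` are both minimal subsets of the predecessors of `j` rendering `X_j`
conditionally independent of all its other predecessors, then `K = K'`. -/
theorem markovian_parents_unique
    {n : ℕ} {Ω : Fin n → Type*} [∀ i, Fintype (Ω i)] [∀ i, Nonempty (Ω i)]
    [∀ i, DecidableEq (Ω i)]
    (P : (∀ i, Ω i) → ℝ)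
    (hPpos : ∀ x, 0 < P x) (hPsum : ∑ x, P x = 1)
    (j : Fin n) (K K' : Finset (Fin n))
    (hKpred : K ⊆ Finset.Iio j) (hK'pred : K' ⊆ Finset.Iio j)
    (hK : Screens P j K) (hKmin : ∀ K'' ⊂ K, ¬ Screens P j K'')
    (hK' : Screens P j K') (hK'min : ∀ K'' ⊂ K', ¬ Screens P j K'') :
    K = K' := by
  have hS := Screens.inter hPpos hKpred hK'pred hK hK'
  have h : K ∩ K' = K := by
    by_contra h
    exact hKmin _ (Finset.inter_subset_left.ssubset_of_ne h) hS
  have h' : K ∩ K' = K' := by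
    by_contra h
    exact hK'min _ (Finset.inter_subset_right.ssubset_of_ne h) hS
  exact h.symm.trans h'
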